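/- In the random lattice path model of length n, the expected number of up-from-zero situations satisfies E[U] = (1/2) H^odd_n, i.e. (1/(n+1)) Σ_{ℓ=0}^{n} (1/C(n,ℓ)) Σ_{w∈P(n,ℓ)} U(w) = (1/2) Σ_{m=1}^{n} [m odd]/m. -/

import Mathlib

/-- The step value of a lattice path: `true` is an up-step (+1), `false` a down-step (−1). -/
def pathStep (b : Bool) : ℤ := if b then 1 else -1

/-- Partial sum `s_t(w) = Σ_{i<t} w(i)` of a lattice path of length `n`. -/
def psum {n : ℕ} (w : Fin n → Bool) (t : ℕ) : ℤ :=
  ∑ i ∈ Finset.univ.filter (fun i : Fin n => (i : ℕ) < t), pathStep (w i)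

/-- `P(n,ℓ)`: lattice paths of length `n` with exactly `ℓ` down-steps. -/
def paths (n ℓ : ℕ) : Finset (Fin n → Bool) :=
  Finset.univ.filter (fun w => (Finset.univ.filter (fun i => w i = false)).card = ℓ)

/-- `U(w)`: the number of up-from-zero situations of `w`, i.e. indices
`t ∈ {0,…,n−1}` with `s_t(w) = 0` and `w(t) = +1`. -/
def numUpFromZero {n : ℕ} (w : Fin n → Bool) : ℕ :=
  (Finset.univ.filter (fun i : Fin n => psum w (i : ℕ) = 0 ∧ w i = true)).card

/-- The number of down-steps of a lattice path. -/
def numDown {n : ℕ} (w : Fin n → Bool) : ℕ :=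
  (Finset.univ.filter (fun i => w i = false)).card

/-- The probability of a single path of length `n` with `d` down-steps. -/
noncomputable def pathWeight (n d : ℕ) : ℝ := 1 / ((n : ℝ) + 1) * (1 / (n.choose d : ℝ))

theorem numDown_le {n : ℕ} (w : Fin n → Bool) : numDown w ≤ n := by
  simpa [numDown] using
    Finset.card_filter_le (Finset.univ : Finset (Fin n)) (fun i => w i = false)

theorem sum_snoc_paths {M : Type*} [AddCommMonoid M] {n : ℕ} (g : (Fin (n + 1) → Bool) → M) :
    ∑ w, g w = ∑ w : Fin n → Bool,
      (g (Fin.snoc (α := fun _ => Bool) w true) + g (Fin.snoc (α := fun _ => Bool) w false)) := by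
  rw [← (Fin.snocEquiv (fun _ : Fin (n + 1) => Bool)).sum_comp, Fintype.sum_prod_type,
    Fintype.sum_bool, ← Finset.sum_add_distrib]
  rfl

theorem numDown_snoc {n : ℕ} (w : Fin n → Bool) (b : Bool) :
    numDown (Fin.snoc (α := fun _ => Bool) w b) = numDown w + if b = false then 1 else 0 := by
  simp only [numDown, Finset.card_filter, Fin.sum_univ_castSucc, Fin.snoc_castSucc, Fin.snoc_last]

theorem psum_snoc {n t : ℕ} (w : Fin n → Bool) (b : Bool) (ht : t ≤ n) :
    psum (Fin.snoc (α := fun _ => Bool) w b) t = psum w t := by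
  simp only [psum, Finset.sum_filter, Fin.sum_univ_castSucc, Fin.snoc_castSucc, Fin.snoc_last,
    Fin.val_castSucc, Fin.val_last, if_neg ht.not_gt, add_zero]

theorem psum_length {n : ℕ} (w : Fin n → Bool) : psum w n = n - 2 * (numDown w : ℤ) := by
  have h : ∀ b : Bool, pathStep b = 1 - 2 * (if b = false then 1 else 0) := by decide
  simp only [psum, numDown, Fin.is_lt, Finset.filter_true, h, Finset.sum_sub_distrib,
    ← Finset.mul_sum, Finset.sum_boole]
  simp

theorem numUpFromZero_snoc {n : ℕ} (w : Fin n → Bool) (b : Bool) :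
    numUpFromZero (Fin.snoc (α := fun _ => Bool) w b)
      = numUpFromZero w + if n = 2 * numDown w ∧ b = true then 1 else 0 := by
  have h : psum w n = 0 ↔ n = 2 * numDown w := by rw [psum_length]; omega
  simp only [numUpFromZero, Finset.card_filter, Fin.sum_univ_castSucc, Fin.snoc_castSucc,
    Fin.snoc_last, Fin.val_castSucc, Fin.val_last, psum_snoc w b le_rfl, h]
  congr 1
  exact Finset.sum_congr rfl fun i _ => by rw [psum_snoc w b i.isLt.le]

theorem sum_numDown_eq (n ℓ : ℕ) :
    ∑ w : Fin n → Bool, (if numDown w = ℓ then 1 else 0) = n.choose ℓ := by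
  induction n generalizing ℓ with
  | zero => cases ℓ <;> simp [numDown]
  | succ n ih =>
    rw [sum_snoc_paths, Finset.sum_add_distrib]
    cases ℓ with
    | zero => simpa [numDown_snoc] using ih 0
    | succ ℓ =>
      simp only [numDown_snoc, Bool.true_eq_false, if_false, if_true, add_zero,
        Nat.add_right_cancel_iff, ih]
      rw [Nat.choose_succ_succ, add_comm]

theorem pathWeight_add {n d : ℕ} (h : d ≤ n) :
    pathWeight (n + 1) d + pathWeight (n + 1) (d + 1) = pathWeight n d := by
  have h1 : ((n : ℝ) + 1) * n.choose d = (n + 1).choose (d + 1) * (d + 1) := by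
    exact_mod_cast Nat.add_one_mul_choose_eq n d
  have h2 : (n.choose d : ℝ) * (n + 1) = (n + 1).choose d * (n + 1 - d) := by
    have := Nat.choose_mul_succ_eq n d
    rw [← Nat.cast_inj (R := ℝ)] at this
    push_cast [Nat.cast_sub (Nat.le_succ_of_le h)] at this
    exact this
  have hd : (d : ℝ) ≤ n := by exact_mod_cast h
  have p0 : (0 : ℝ) < n.choose d := by exact_mod_cast Nat.choose_pos h
  have e1 : ((n + 1).choose (d + 1) : ℝ) = (n + 1) * n.choose d / (d + 1) := by
    rw [h1]; field_simp
  have q : (0 : ℝ) < n + 1 - d := by linarith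
  have e2 : ((n + 1).choose d : ℝ) = (n + 1) * n.choose d / (n + 1 - d) := by
    rw [eq_div_iff q.ne', ← h2]; ring
  simp only [pathWeight, e1, e2]
  push_cast
  field_simp
  ring

theorem choose_mul_pathWeight (k : ℕ) :
    ((2 * k).choose k : ℝ) * pathWeight (2 * k + 1) k = 1 / 2 * (1 / ((2 * k + 1 : ℕ) : ℝ)) := by
  have h := Nat.choose_mul_succ_eq (2 * k) k
  rw [show 2 * k + 1 - k = k + 1 by omega, ← Nat.cast_inj (R := ℝ)] at h
  push_cast at h
  have p : (0 : ℝ) < (2 * k).choose k := by exact_mod_cast Nat.choose_pos (by omega)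
  have e : ((2 * k + 1).choose k : ℝ) = (2 * k).choose k * (2 * k + 1) / (k + 1) := by
    rw [h]; field_simp
  simp only [pathWeight, e]
  push_cast
  field_simp
  ring

theorem sum_pathWeight_return (n : ℕ) :
    ∑ w : Fin n → Bool, (if n = 2 * numDown w then pathWeight (n + 1) (numDown w) else 0)
      = 1 / 2 * if Odd (n + 1) then 1 / ((n + 1 : ℕ) : ℝ) else 0 := by
  rcases Nat.even_or_odd' n with ⟨k, rfl | rfl⟩
  · rw [if_pos (odd_two_mul_add_one k), ← choose_mul_pathWeight, ← sum_numDown_eq,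
      Nat.cast_sum, Finset.sum_mul]
    refine Finset.sum_congr rfl fun w _ => ?_
    by_cases hw : numDown w = k
    · simp [hw]
    · rw [if_neg (by omega), if_neg hw]; simp
  · rw [if_neg (by rw [Nat.not_odd_iff_even]; exact ⟨k + 1, by ring⟩), mul_zero]
    exact Finset.sum_eq_zero fun w _ => if_neg (by omega)

theorem sum_pathWeight_mul_numUpFromZero (n : ℕ) :
    ∑ w : Fin n → Bool, pathWeight n (numDown w) * (numUpFromZero w : ℝ)
      = 1 / 2 * ∑ m ∈ Finset.Icc 1 n, if Odd m then (1 : ℝ) / m else 0 := by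
  induction n with
  | zero => simp [numUpFromZero]
  | succ n ih =>
    rw [Finset.sum_Icc_succ_top (by omega), mul_add, ← ih, ← sum_pathWeight_return,
      sum_snoc_paths, ← Finset.sum_add_distrib]
    refine Finset.sum_congr rfl fun w _ => ?_
    rw [← pathWeight_add (numDown_le w)]
    simp only [numDown_snoc, numUpFromZero_snoc]
    split_ifs <;> simp_all <;> ring

/-- In the random lattice path model of length `n`, the expected number of up-from-zero
situations is `(1/2)·H^odd_n`. -/
theorem expected_up_from_zero (n : ℕ) :
    (1 / ((n : ℝ) + 1)) * ∑ ℓ ∈ Finset.range (n + 1),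
      (1 / (n.choose ℓ : ℝ)) * ∑ w ∈ paths n ℓ, (numUpFromZero w : ℝ)
    = (1 / 2) * ∑ m ∈ Finset.Icc 1 n, if Odd m then (1 : ℝ) / m else 0 := by
  rw [← sum_pathWeight_mul_numUpFromZero, Finset.mul_sum,
    ← Finset.sum_fiberwise_of_maps_to (t := Finset.range (n + 1)) (g := numDown)
      (fun w _ => Finset.mem_range_succ_iff.mpr (numDown_le w))]
  refine Finset.sum_congr rfl fun ℓ _ => ?_
  rw [← mul_assoc, Finset.mul_sum]
  refine Finset.sum_congr rfl fun w hw => ?_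
  rw [(Finset.mem_filter.mp hw).2, pathWeight]
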